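/- Let φ be a flow on a generalized Peano continuum M and let Λ be a compact minimal set. If any of the following holds: (1) CMin is not locally connected at Λ; (2) Λ has no locally connected neighborhood in CMin; (3) Λ has no compact neighborhood in CMin — then every neighborhood of Λ in M contains a Lyapunov unstable compact minimal set. -/

import Mathlib

open Set Filter Topology Metric TopologicalSpace

variable {M : Type*} [MetricSpace M]

/-- A set is invariant under the flow `φ`. -/
def IsFlowInvariant (φ : ℝ → M → M) (K : Set M) : Prop :=
  ∀ x ∈ K, ∀ t : ℝ, φ t x ∈ K

/-- A set is positively invariant under the flow `φ`. -/
def IsPosInvariant (φ : ℝ → M → M) (K : Set M) : Prop :=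
  ∀ x ∈ K, ∀ t : ℝ, 0 ≤ t → φ t x ∈ K

/-- A compact minimal set: nonempty, compact, invariant, with no nonempty proper
closed invariant subset. -/
def IsCompactMinimalSet (φ : ℝ → M → M) (K : Set M) : Prop :=
  K.Nonempty ∧ IsCompact K ∧ IsFlowInvariant φ K ∧
    ∀ K' ⊆ K, K'.Nonempty → IsClosed K' → IsFlowInvariant φ K' → K' = K

/-- Lyapunov stability: every neighborhood of `K` contains a positively invariant
neighborhood of `K`. -/
def IsLyapunovStable (φ : ℝ → M → M) (K : Set M) : Prop :=
  ∀ U ∈ 𝓝ˢ K, ∃ V ∈ 𝓝ˢ K, V ⊆ U ∧ IsPosInvariant φ V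

/-- The ω-limit set of a point. -/
def omegaLimitSet (φ : ℝ → M → M) (x : M) : Set M :=
  ⋂ T ∈ Ici (0 : ℝ), closure ((fun t => φ t x) '' Ici T)

/-- The α-limit set of a point. -/
def alphaLimitSet (φ : ℝ → M → M) (x : M) : Set M :=
  ⋂ T ∈ Iic (0 : ℝ), closure ((fun t => φ t x) '' Iic T)

/-- A compact minimal set is hyper-stable if some neighborhood of it in `M` meets no
Lyapunov unstable compact minimal set. -/
def IsHyperStable (φ : ℝ → M → M) (Λ : Set M) : Prop :=
  IsCompactMinimalSet φ Λ ∧ ∃ W ∈ 𝓝ˢ Λ, ∀ Γ : Set M,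
    IsCompactMinimalSet φ Γ → ¬ IsLyapunovStable φ Γ → Γ ∩ W = ∅

/-- An attractor: a Lyapunov stable nonempty compact invariant set whose basin of
attraction is a neighborhood of it. -/
def IsAttractorSet (φ : ℝ → M → M) (Δ : Set M) : Prop :=
  Δ.Nonempty ∧ IsCompact Δ ∧ IsFlowInvariant φ Δ ∧ IsLyapunovStable φ Δ ∧
    {x : M | (omegaLimitSet φ x).Nonempty ∧ omegaLimitSet φ x ⊆ Δ} ∈ 𝓝ˢ Δ

/-- The flow is non-wandering. -/
def IsNonWanderingFlow (φ : ℝ → M → M) : Prop :=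
  ∀ x : M, ∀ U ∈ 𝓝 x, ∀ T > (0 : ℝ), ∃ t ≥ T, ((fun y => φ t y) '' U ∩ U).Nonempty

/-- The set of hyper-stable compact minimal sets, as a subset of the space of nonempty
compact subsets of `M` (with the Hausdorff metric). -/
def HSset (φ : ℝ → M → M) : Set (NonemptyCompacts M) :=
  {Γ | IsHyperStable φ (Γ : Set M)}

/-- The set of all compact minimal sets, as a subset of the space of nonempty compact
subsets of `M` (with the Hausdorff metric). -/
def CMinSet (φ : ℝ → M → M) : Set (NonemptyCompacts M) :=
  {Γ | IsCompactMinimalSet φ (Γ : Set M)}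

/-- `basinOf φ X` is the set of points whose ω-limit set belongs to `X`. -/
def basinOf (φ : ℝ → M → M) (X : Set (NonemptyCompacts M)) : Set M :=
  {x | ∃ Γ ∈ X, (Γ : Set M) = omegaLimitSet φ x}

/-- The union in `M` of a family of hyper-stable compact minimal sets. -/
def unionSet (φ : ℝ → M → M) (X : Set ↥(HSset φ)) : Set M :=
  {y | ∃ q ∈ X, y ∈ ((q : NonemptyCompacts M) : Set M)}

/-- Near a compact minimal set, the Hausdorff topology on compact minimal sets is controlled from
above only: `Γ` is close to `q` as soon as `Γ` is contained in a small neighborhood of `q`. -/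
theorem nhds_cMinSet_eq {φ : ℝ → M → M} (hφ : Continuous fun p : ℝ × M => φ p.1 p.2)
    (hφzero : ∀ x : M, φ 0 x = x) (hφadd : ∀ s t : ℝ, ∀ x : M, φ s (φ t x) = φ (s + t) x)
    (q : CMinSet φ) :
    𝓝 q = comap (fun r : CMinSet φ => ((r : NonemptyCompacts M) : Set M))
      (𝓝ˢ ((q : NonemptyCompacts M) : Set M)).smallSets := by
  apply le_antisymm
  · rw [← tendsto_iff_comap, tendsto_smallSets_iff]
    intro O hO
    obtain ⟨O', hO', hqO', hO'O⟩ := mem_nhdsSet_iff_exists.1 hO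
    have h_open : IsOpen {K : NonemptyCompacts M | (K : Set M) ⊆ O'} :=
      NonemptyCompacts.isOpen_subsets_of_isOpen hO'
    filter_upwards [(h_open.preimage continuous_subtype_val).mem_nhds hqO'] with r hr
    exact Subset.trans hr hO'O
  · let := TopologicalSpace.vietoris M
    rw [nhds_subtype_eq_comap, NonemptyCompacts.isEmbedding_coe.nhds_eq_comap, comap_comap,
      ← tendsto_iff_comap, TopologicalSpace.tendsto_nhds_generateFrom_iff]
    rintro _ (⟨U, hU, rfl⟩ | ⟨U, hU, rfl⟩) hqU
    · exact mem_comap.2 ⟨_, eventually_smallSets.2 ⟨U, hU.mem_nhdsSet.2 hqU, fun _ h => h⟩, fun r hr => hr⟩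
    · obtain ⟨-, hqc, hqi, hqm⟩ := q.2
      have hO : IsOpen (⋃ t, φ t ⁻¹' U) :=
        isOpen_iUnion fun t => hU.preimage (hφ.comp (by fun_prop : Continuous fun x : M => (t, x)))
      have hqO : ((q : NonemptyCompacts M) : Set M) ⊆ ⋃ t, φ t ⁻¹' U := by
        by_contra hcon
        have h_eq := hqm (((q : NonemptyCompacts M) : Set M) \ ⋃ t, φ t ⁻¹' U) sdiff_subset
          (sdiff_nonempty.2 hcon) (hqc.isClosed.sdiff hO) fun x hx t => ⟨hqi x hx.1 t, fun hxt => by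
            obtain ⟨s, hs⟩ := mem_iUnion.1 hxt
            exact hx.2 (mem_iUnion.2 ⟨s + t, by simpa [hφadd] using hs⟩)⟩
        obtain ⟨z, hz, hzU⟩ := hqU
        exact (h_eq.symm.subset hz).2 (mem_iUnion.2 ⟨0, by simpa [hφzero] using hzU⟩)
      refine mem_comap.2 ⟨_, eventually_smallSets.2 ⟨_, hO.mem_nhdsSet.2 hqO, fun _ h => h⟩, fun r hr => ?_⟩
      obtain ⟨⟨x, hx⟩, -, hri, -⟩ := r.2
      obtain ⟨t, ht⟩ := mem_iUnion.1 (hr hx)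
      exact ⟨φ t x, hri x hx t, ht⟩

/-- A nonempty compact invariant set contains a compact minimal set. -/
theorem exists_isCompactMinimalSet_subset {φ : ℝ → M → M} {K : Set M} (hne : K.Nonempty)
    (hK : IsCompact K) (hinv : IsFlowInvariant φ K) : ∃ Γ ⊆ K, IsCompactMinimalSet φ Γ := by
  obtain ⟨Γ, hΓK, hΓ⟩ := zorn_superset_nonempty
    {A : Set M | A.Nonempty ∧ IsClosed A ∧ A ⊆ K ∧ IsFlowInvariant φ A}
    (fun c hcS hc hcne => by
      refine ⟨⋂₀ c, ⟨?_, ?_, ?_, ?_⟩, fun s hs => sInter_subset_of_mem hs⟩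
      · have : Nonempty c := hcne.to_subtype
        refine IsCompact.nonempty_sInter_of_directed_nonempty_isCompact_isClosed ?_ ?_ ?_ ?_
        · exact fun A hA B hB => (hc.total hA hB).elim (fun h => ⟨A, hA, Subset.rfl, h⟩)
            fun h => ⟨B, hB, h, Subset.rfl⟩
        · exact fun A hA => (hcS hA).1
        · exact fun A hA => hK.of_isClosed_subset (hcS hA).2.1 (hcS hA).2.2.1
        · exact fun A hA => (hcS hA).2.1
      · exact isClosed_sInter fun A hA => (hcS hA).2.1
      · obtain ⟨A, hA⟩ := hcne
        exact (sInter_subset_of_mem hA).trans (hcS hA).2.2.1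
      · exact fun x hx t A hA => (hcS hA).2.2.2 x (hx A hA) t)
    K ⟨hne, hK.isClosed, Subset.rfl, hinv⟩
  obtain ⟨hΓne, hΓc, -, hΓi⟩ := hΓ.prop
  refine ⟨Γ, hΓK, hΓne, hK.of_isClosed_subset hΓc hΓK, hΓi, fun A hA hAne hAc hAi => ?_⟩
  exact hA.antisymm (hΓ.le_of_le ⟨hAne, hAc, hA.trans hΓK, hAi⟩ hA)

/-- A compact minimal set is the closure of an orbit, hence preconnected. -/
theorem IsCompactMinimalSet.isPreconnected {φ : ℝ → M → M}
    (hφ : Continuous fun p : ℝ × M => φ p.1 p.2)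
    (hφadd : ∀ s t : ℝ, ∀ x : M, φ s (φ t x) = φ (s + t) x) {Γ : Set M}
    (hΓ : IsCompactMinimalSet φ Γ) : IsPreconnected Γ := by
  obtain ⟨⟨x, hx⟩, hc, hi, hm⟩ := hΓ
  have h_sub : closure (range fun t => φ t x) ⊆ Γ :=
    closure_minimal (range_subset_iff.2 fun t => hi x hx t) hc.isClosed
  rw [← hm _ h_sub (range_nonempty _).closure isClosed_closure]
  · exact (isPreconnected_range (hφ.comp (by fun_prop : Continuous fun t : ℝ => (t, x)))).closure
  · intro z hz s
    refine map_mem_closure (hφ.comp (by fun_prop : Continuous fun x : M => (s, x))) hz ?_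
    rintro _ ⟨t, rfl⟩
    exact ⟨s + t, (hφadd s t x).symm⟩

theorem isClosed_omegaLimitSet (φ : ℝ → M → M) (x : M) : IsClosed (omegaLimitSet φ x) :=
  isClosed_biInter fun _ _ => isClosed_closure

theorem isFlowInvariant_omegaLimitSet {φ : ℝ → M → M}
    (hφ : Continuous fun p : ℝ × M => φ p.1 p.2)
    (hφadd : ∀ s t : ℝ, ∀ x : M, φ s (φ t x) = φ (s + t) x) (x : M) :
    IsFlowInvariant φ (omegaLimitSet φ x) := by
  refine fun z hz s => mem_iInter₂.2 fun T _ => ?_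
  refine map_mem_closure (hφ.comp (by fun_prop : Continuous fun x : M => (s, x)))
    (mem_iInter₂.1 hz (max (T - s) 0) (mem_Ici.2 (le_max_right _ _))) ?_
  rintro _ ⟨t, ht, rfl⟩
  refine ⟨s + t, ?_, (hφadd s t x).symm⟩
  have := (le_max_left (T - s) 0).trans ht
  simp only [mem_Ici]
  linarith

theorem IsPosInvariant.omegaLimitSet_subset_closure {φ : ℝ → M → M}
    (hφadd : ∀ s t : ℝ, ∀ x : M, φ s (φ t x) = φ (s + t) x) {V : Set M}
    (hV : IsPosInvariant φ V) {x : M} {t : ℝ} (ht : 0 ≤ t) (hx : φ t x ∈ V) :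
    omegaLimitSet φ x ⊆ closure V := by
  refine (iInter₂_subset t ht).trans (closure_mono ?_)
  rintro _ ⟨s, hs, rfl⟩
  simpa [hφadd] using hV _ hx (s - t) (sub_nonneg.2 hs)

theorem IsPosInvariant.omegaLimitSet_nonempty {φ : ℝ → M → M} {D : Set M}
    (hD : IsPosInvariant φ D) (hDc : IsCompact D) {x : M} (hx : x ∈ D) :
    (omegaLimitSet φ x).Nonempty := by
  obtain ⟨z, -, hz⟩ := hDc.exists_mapClusterPt (f := atTop) (u := fun t => φ t x)
    (tendsto_principal.2 ((eventually_ge_atTop 0).mono fun t ht => hD x hx t ht))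
  refine ⟨z, mem_iInter₂.2 fun T _ => ?_⟩
  exact ClusterPt.mem_closure_of_mem hz _ (image_mem_map (Ici_mem_atTop T))

theorem IsPosInvariant.closure {φ : ℝ → M → M} (hφ : Continuous fun p : ℝ × M => φ p.1 p.2)
    {V : Set M} (hV : IsPosInvariant φ V) : IsPosInvariant φ (closure V) := fun _ hx t ht =>
  map_mem_closure (hφ.comp (by fun_prop : Continuous fun x : M => (t, x))) hx
    fun y hy => hV y hy t ht

/-- On a compact positively invariant set all of whose compact minimal subsets are Lyapunov stable,
some map selecting a compact minimal set in the ω-limit set of each point is continuous. -/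
theorem exists_continuous_omegaLimit_selection [LocallyCompactSpace M] {φ : ℝ → M → M}
    (hφ : Continuous fun p : ℝ × M => φ p.1 p.2) (hφzero : ∀ x : M, φ 0 x = x)
    (hφadd : ∀ s t : ℝ, ∀ x : M, φ s (φ t x) = φ (s + t) x) {D : Set M} (hDc : IsCompact D)
    (hD : IsPosInvariant φ D)
    (hstab : ∀ Γ ⊆ D, IsCompactMinimalSet φ Γ → IsLyapunovStable φ Γ) :
    ∃ r : D → CMinSet φ, Continuous r ∧
      (∀ x, ((r x : NonemptyCompacts M) : Set M) ⊆ D) ∧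
      ∀ (q : CMinSet φ) (x : D), (x : M) ∈ (q : NonemptyCompacts M) → r x = q := by
  have h_sub (x : D) : omegaLimitSet φ x ⊆ D := by
    simpa [hDc.isClosed.closure_eq] using
      hD.omegaLimitSet_subset_closure hφadd le_rfl (by simp [hφzero] : φ 0 (x : M) ∈ D)
  have h_ex (x : D) : ∃ q : CMinSet φ,
      ((q : NonemptyCompacts M) : Set M) ⊆ omegaLimitSet φ x := by
    obtain ⟨Γ, hΓ, hm⟩ := exists_isCompactMinimalSet_subset (hD.omegaLimitSet_nonempty hDc x.2)
      (hDc.of_isClosed_subset (isClosed_omegaLimitSet φ _) (h_sub x))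
      (isFlowInvariant_omegaLimitSet hφ hφadd _)
    exact ⟨⟨⟨⟨Γ, hm.2.1⟩, hm.1⟩, hm⟩, hΓ⟩
  choose r hr using h_ex
  refine ⟨r, ?_, fun x => (hr x).trans (h_sub x), fun q x hx => ?_⟩
  · refine continuous_iff_continuousAt.2 fun x => ?_
    rw [ContinuousAt, nhds_cMinSet_eq hφ hφzero hφadd, tendsto_comap_iff, tendsto_smallSets_iff]
    intro O hO
    obtain ⟨O', hO', hrO', hO'O⟩ := mem_nhdsSet_iff_exists.1 hO
    obtain ⟨N, hNc, hrN, hNO'⟩ := exists_compact_between (r x).1.isCompact hO' hrO'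
    obtain ⟨V, hV, hVN, hVi⟩ := hstab _ ((hr x).trans (h_sub x)) (r x).2 N
      (mem_nhdsSet_iff_exists.2 ⟨_, isOpen_interior, hrN, interior_subset⟩)
    obtain ⟨z, hz⟩ := (r x).1.nonempty
    obtain ⟨_, hw, ⟨t, ht, rfl⟩⟩ := mem_closure_iff.1
      (mem_iInter₂.1 (hr x hz) 0 self_mem_Ici) _ isOpen_interior
      (subset_interior_iff_mem_nhdsSet.2 hV hz)
    have h_cont : Continuous fun y : D => φ t (y : M) :=
      hφ.comp (by fun_prop : Continuous fun y : D => (t, (y : M)))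
    filter_upwards [(isOpen_interior.preimage h_cont).mem_nhds hw] with y hy
    exact ((hr y).trans (hVi.omegaLimitSet_subset_closure hφadd ht (interior_subset hy))).trans
      ((closure_minimal hVN hNc.isClosed).trans (hNO'.trans hO'O))
  · obtain ⟨-, hqc, hqi, hqm⟩ := q.2
    have hrq : ((r x : NonemptyCompacts M) : Set M) ⊆ (q : NonemptyCompacts M) := by
      refine (hr x).trans ?_
      have hqp : IsPosInvariant φ ((q : NonemptyCompacts M) : Set M) := fun y hy t _ => hqi y hy t
      simpa [hqc.isClosed.closure_eq] using hqp.omegaLimitSet_subset_closure hφadd le_rfl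
        (by simpa [hφzero] using hx : φ 0 (x : M) ∈ _)
    exact Subtype.ext (NonemptyCompacts.ext
      (hqm _ hrq (r x).1.nonempty (r x).1.isCompact.isClosed (r x).2.2.2.1))

/-- If all compact minimal sets near `q` are Lyapunov stable, then small neighborhoods of `q` are
mapped continuously onto neighborhoods of `q` in the space of compact minimal sets. -/
theorem exists_continuous_selection_near [LocallyCompactSpace M] {φ : ℝ → M → M}
    (hφ : Continuous fun p : ℝ × M => φ p.1 p.2) (hφzero : ∀ x : M, φ 0 x = x)
    (hφadd : ∀ s t : ℝ, ∀ x : M, φ s (φ t x) = φ (s + t) x) (q : CMinSet φ) {W : Set M}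
    (hW : W ∈ 𝓝ˢ ((q : NonemptyCompacts M) : Set M))
    (hstab : ∀ Γ ⊆ W, IsCompactMinimalSet φ Γ → IsLyapunovStable φ Γ)
    {U : Set (CMinSet φ)} (hU : U ∈ 𝓝 q) :
    ∃ (D : Set M) (r : D → CMinSet φ), IsCompact D ∧
      D ∈ 𝓝ˢ ((q : NonemptyCompacts M) : Set M) ∧ Continuous r ∧ range r ⊆ U ∧
      ∀ S ∈ 𝓝ˢ ((q : NonemptyCompacts M) : Set M), r '' ((↑) ⁻¹' S) ∈ 𝓝 q := by
  rw [nhds_cMinSet_eq hφ hφzero hφadd] at hU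
  obtain ⟨A, hA, hAU⟩ := mem_comap.1 hU
  obtain ⟨O, hO, hOA⟩ := eventually_smallSets.1 hA
  obtain ⟨O', hO', hqO', hO'O⟩ := mem_nhdsSet_iff_exists.1 (inter_mem hO hW)
  obtain ⟨N, hNc, hqN, hNO'⟩ := exists_compact_between q.1.isCompact hO' hqO'
  obtain ⟨V, hV, hVN, hVi⟩ := hstab _ (subset_of_mem_nhdsSet hW) q.2 N
    (mem_nhdsSet_iff_exists.2 ⟨_, isOpen_interior, hqN, interior_subset⟩)
  have hVN' : closure V ⊆ N := closure_minimal hVN hNc.isClosed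
  have hVc : IsCompact (closure V) := hNc.of_isClosed_subset isClosed_closure hVN'
  have hDO : closure V ⊆ O ∩ W := hVN'.trans (hNO'.trans hO'O)
  obtain ⟨r, hrc, hrD, hr⟩ := exists_continuous_omegaLimit_selection hφ hφzero hφadd hVc
    (hVi.closure hφ) fun Γ hΓ => hstab Γ (hΓ.trans (hDO.trans inter_subset_right))
  have hD : closure V ∈ 𝓝ˢ ((q : NonemptyCompacts M) : Set M) := mem_of_superset hV subset_closure
  refine ⟨closure V, r, hVc, hD, hrc, ?_, fun S hS => ?_⟩
  · rintro _ ⟨x, rfl⟩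
    exact hAU (hOA _ ((hrD x).trans (hDO.trans inter_subset_left)))
  · rw [nhds_cMinSet_eq hφ hφzero hφadd]
    refine mem_comap.2 ⟨_, eventually_smallSets.2 ⟨_, inter_mem hS hD, fun _ h => h⟩, fun s hs => ?_⟩
    obtain ⟨y, hy⟩ := s.1.nonempty
    exact ⟨⟨y, (hs hy).2⟩, (hs hy).1, hr s _ hy⟩

/-- If all compact minimal sets near `q` are Lyapunov stable, then `q` has arbitrarily small
connected neighborhoods in the space of compact minimal sets. -/
theorem exists_isConnected_mem_nhds_cMinSet [LocallyCompactSpace M] [LocallyConnectedSpace M]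
    {φ : ℝ → M → M} (hφ : Continuous fun p : ℝ × M => φ p.1 p.2) (hφzero : ∀ x : M, φ 0 x = x)
    (hφadd : ∀ s t : ℝ, ∀ x : M, φ s (φ t x) = φ (s + t) x) (q : CMinSet φ) {W : Set M}
    (hW : W ∈ 𝓝ˢ ((q : NonemptyCompacts M) : Set M))
    (hstab : ∀ Γ ⊆ W, IsCompactMinimalSet φ Γ → IsLyapunovStable φ Γ)
    {U : Set (CMinSet φ)} (hU : U ∈ 𝓝 q) : ∃ V ∈ 𝓝 q, V ⊆ U ∧ IsConnected V := by
  obtain ⟨D, r, -, hD, hrc, hrU, hr⟩ :=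
    exists_continuous_selection_near hφ hφzero hφadd q hW hstab hU
  obtain ⟨x, hx⟩ := q.1.nonempty
  have hqD := subset_interior_iff_mem_nhdsSet.2 hD
  have hSD : connectedComponentIn (interior D) x ⊆ D :=
    (connectedComponentIn_subset _ _).trans interior_subset
  have h_mem := hr (connectedComponentIn (interior D) x)
    (isOpen_interior.connectedComponentIn.mem_nhdsSet.2
      ((q.2.isPreconnected hφ hφadd).subset_connectedComponentIn hx hqD))
  refine ⟨_, h_mem, (image_subset_range _ _).trans hrU, ⟨q, mem_of_mem_nhds h_mem⟩, ?_⟩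
  refine IsPreconnected.image ?_ r hrc.continuousOn
  rw [← IsInducing.subtypeVal.isPreconnected_image, Subtype.image_preimage_coe,
    inter_eq_right.2 hSD]
  exact isPreconnected_connectedComponentIn

theorem unstable_minimals_near_of_bad_local_topology [LocallyCompactSpace M] [ConnectedSpace M] [LocallyConnectedSpace M]
    (φ : ℝ → M → M)
    (hφcont : Continuous fun p : ℝ × M => φ p.1 p.2)
    (hφzero : ∀ x : M, φ 0 x = x)
    (hφadd : ∀ s t : ℝ, ∀ x : M, φ s (φ t x) = φ (s + t) x)
    (p : ↥(CMinSet φ))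
    (h : (¬ ∀ U ∈ 𝓝 p, ∃ V ∈ 𝓝 p, V ⊆ U ∧ IsConnected V) ∨
         (¬ ∃ V ∈ 𝓝 p, LocallyConnectedSpace ↥V) ∨
         (¬ ∃ V ∈ 𝓝 p, IsCompact V)) :
    ∀ W ∈ 𝓝ˢ (((p : NonemptyCompacts M) : Set M)), ∃ Γ : Set M, Γ ⊆ W ∧
      IsCompactMinimalSet φ Γ ∧ ¬ IsLyapunovStable φ Γ := by
  intro W hW
  by_contra! hcon
  have hstab : ∀ Γ ⊆ W, IsCompactMinimalSet φ Γ → IsLyapunovStable φ Γ := hcon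
  rcases h with h | h | h
  · exact h fun U hU =>
      exists_isConnected_mem_nhds_cMinSet hφcont hφzero hφadd p hW hstab hU
  · let N : Set (CMinSet φ) := {q | ((q : NonemptyCompacts M) : Set M) ⊆ interior W}
    have hN : IsOpen N := (NonemptyCompacts.isOpen_subsets_of_isOpen isOpen_interior).preimage
      continuous_subtype_val
    refine h ⟨N, hN.mem_nhds (subset_interior_iff_mem_nhdsSet.2 hW), ?_⟩
    refine locallyConnectedSpace_iff_connected_subsets.2 fun q U hU => ?_
    obtain ⟨V, hV, hVU, hVc⟩ := exists_isConnected_mem_nhds_cMinSet hφcont hφzero hφadd q.1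
      (subset_interior_iff_mem_nhdsSet.1 q.2) hstab (hN.isOpenEmbedding_subtypeVal.image_mem_nhds.2 hU)
    refine ⟨(↑) ⁻¹' V, continuous_subtype_val.continuousAt.preimage_mem_nhds hV, ?_, ?_⟩
    · rw [← IsInducing.subtypeVal.isPreconnected_image,
        image_preimage_eq_of_subset (hVU.trans (image_subset_range _ _))]
      exact hVc.isPreconnected
    · rw [← preimage_image_eq U Subtype.val_injective]
      exact preimage_mono hVU
  · obtain ⟨D, r, hDc, hD, hrc, -, hr⟩ :=
      exists_continuous_selection_near hφcont hφzero hφadd p hW hstab univ_mem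
    have : CompactSpace D := isCompact_iff_compactSpace.1 hDc
    exact h ⟨range r, mem_of_superset (hr D hD) (image_subset_range _ _), isCompact_range hrc⟩
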